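/- Let g be a finite-dimensional semisimple complex Lie algebra and θ ∈ Aut(g) of finite order. Then the fixed-point subalgebra g^θ is reductive in g, i.e., g is a semisimple g^θ-module under the adjoint action of g^θ. -/

import Mathlib

namespace RedFix
open LieModule LieAlgebra Module
universe u

/-- An endomorphism all of whose positive powers are traceless is nilpotent. -/
theorem nilp_of_trace {V : Type*} [AddCommGroup V] [Module ℂ V] [FiniteDimensional ℂ V]
    (c : Module.End ℂ V) (h : ∀ n : ℕ, LinearMap.trace ℂ V (c * c ^ n) = 0) : IsNilpotent c := by
  classical
  have hq : ∀ q : Polynomial ℂ, LinearMap.trace ℂ V (c * Polynomial.aeval c q) = 0 := by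
    intro q
    induction q using Polynomial.induction_on' with
    | add p q hp hq => rw [map_add, mul_add, map_add, hp, hq, add_zero]
    | monomial n a =>
      rw [Polynomial.aeval_monomial, ← Algebra.smul_def, mul_smul_comm, map_smul, h, smul_zero]
  have hne : minpoly ℂ c ≠ 0 := minpoly.ne_zero_of_finite ℂ c
  obtain ⟨r, hr, hdvd⟩ := Polynomial.exists_eq_pow_rootMultiplicity_mul_and_not_dvd
    (minpoly ℂ c) hne 0
  set a := (minpoly ℂ c).rootMultiplicity 0
  rw [Polynomial.C_0, sub_zero] at hr hdvd
  have hcop : IsCoprime (Polynomial.X : Polynomial ℂ) r :=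
    (Polynomial.irreducible_X.coprime_iff_not_dvd).2 hdvd
  obtain ⟨u, v, huv⟩ := hcop.pow_left (m := a + 1)
  have hz : c ^ a * Polynomial.aeval c r = 0 := by
    have := minpoly.aeval ℂ c
    rw [hr] at this
    simpa using this
  have hz' : Polynomial.aeval c (Polynomial.X ^ a * r) = 0 := by simpa using hz
  have he : Polynomial.aeval c (u * Polynomial.X ^ (a + 1)) = 0 := by
    have hid : IsIdempotentElem (Polynomial.aeval c (u * Polynomial.X ^ (a + 1))) := by
      unfold IsIdempotentElem
      rw [← map_mul, ← sub_eq_zero, ← map_sub]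
      have : u * Polynomial.X ^ (a + 1) * (u * Polynomial.X ^ (a + 1)) - u * Polynomial.X ^ (a + 1)
        = (- (u * v * Polynomial.X)) * (Polynomial.X ^ a * r) := by
        linear_combination (u * Polynomial.X ^ (a + 1)) * huv
      rw [this, map_mul, hz', mul_zero]
    apply LinearMap.IsIdempotentElem.eq_zero_of_trace_eq_zero hid
    have : u * Polynomial.X ^ (a + 1) = Polynomial.X * (u * Polynomial.X ^ a) := by ring
    rw [this, map_mul, Polynomial.aeval_X]
    exact hq _
  refine ⟨a, ?_⟩
  have h1 : Polynomial.aeval c (v * r) = 1 := by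
    have := congrArg (Polynomial.aeval c) huv
    rwa [map_add, he, zero_add, map_one] at this
  have : Polynomial.aeval c (v * (Polynomial.X ^ a * r)) = c ^ a := by
    rw [show v * (Polynomial.X ^ a * r) = Polynomial.X ^ a * (v * r) by ring, map_mul, h1]
    simp
  rw [← this, map_mul, hz', mul_zero]

section
attribute [local instance] LieRing.ofAssociativeRing

theorem solvable_of_faithful {K W : Type*} [LieRing K] [LieAlgebra ℂ K] [FiniteDimensional ℂ K]
    [AddCommGroup W] [Module ℂ W] [LieRingModule K W] [LieModule ℂ K W] [FiniteDimensional ℂ W]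
    (hf : ∀ x : K, (∀ w : W, ⁅x, w⁆ = 0) → x = 0) (ht : traceForm ℂ K W = 0) :
    IsSolvable K := by
  have hn := LieModule.isNilpotent_derivedSeries_of_traceForm_eq_zero ht
  have hinj : ∀ x : K, toEnd ℂ K W x = 0 → x = 0 := fun x hx => hf x fun w => by
    rw [← toEnd_apply_apply ℂ K W x w, hx]; rfl
  have hn' : LieRing.IsNilpotent (derivedSeries ℂ K 1) := by
    rw [LieAlgebra.isNilpotent_iff_forall (R := ℂ)]
    intro x
    have h1 : _root_.IsNilpotent (toEnd ℂ K W (x : K)) :=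
      (LieModule.isNilpotent_iff_forall' (R := ℂ)).mp hn x
    obtain ⟨n, h2⟩ := LieAlgebra.ad_nilpotent_of_nilpotent (R := ℂ) h1
    refine ⟨n, ?_⟩
    have key : ∀ (m : ℕ) (y : derivedSeries ℂ K 1),
        toEnd ℂ K W ((((ad ℂ (derivedSeries ℂ K 1)) x ^ m) y : derivedSeries ℂ K 1) : K)
          = ((ad ℂ (Module.End ℂ W)) (toEnd ℂ K W (x : K)) ^ m) (toEnd ℂ K W (y : K)) := by
      intro m
      induction m with
      | zero => intro y; simp
      | succ m ih =>
        intro y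
        rw [pow_succ, pow_succ, Module.End.mul_apply, Module.End.mul_apply, ih]
        congr 1
        simp
    ext y
    have := key n y
    rw [h2] at this
    simpa using hinj _ this
  obtain ⟨k, hk⟩ := IsSolvable.solvable ℂ (derivedSeries ℂ K 1)
  rw [LieIdeal.derivedSeries_eq_bot_iff] at hk
  refine IsSolvable.mk (R := ℂ) (k := k + 1) ?_
  rw [derivedSeries_def, derivedSeriesOfIdeal_add]
  exact hk
end

/-- Invariant dual families for an ideal on which the trace form is nondegenerate. -/
theorem casimir_data {s W : Type*} [LieRing s] [LieAlgebra ℂ s] [FiniteDimensional ℂ s]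
    [AddCommGroup W] [Module ℂ W] [LieRingModule s W] [LieModule ℂ s W] [FiniteDimensional ℂ W]
    (I : LieIdeal ℂ s)
    (hI : ∀ x ∈ I, (∀ y ∈ I, traceForm ℂ s W x y = 0) → x = 0) :
    ∃ b b' : Fin (finrank ℂ I) → s,
      (∑ i, traceForm ℂ s W (b i) (b' i) = finrank ℂ I) ∧
      ∀ (x : s) (Φ : s →ₗ[ℂ] s →ₗ[ℂ] W),
        ∑ i, (Φ ⁅x, b i⁆ (b' i) + Φ (b i) ⁅x, b' i⁆) = 0 := by
  classical
  let B : LinearMap.BilinForm ℂ I := (traceForm ℂ s W).restrict I.toSubmodule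
  have hBapp : ∀ x y : I, B x y = traceForm ℂ s W x y := fun _ _ => rfl
  have hs : B.IsSymm := ⟨fun x y => by
    simp only [hBapp]; exact traceForm_comm ℂ s W _ _⟩
  have hB : B.Nondegenerate := by
    have h0 : B.SeparatingLeft := by
      intro x hx
      apply Subtype.ext
      exact hI x x.2 fun y hy => hx ⟨y, hy⟩
    exact ⟨h0, fun x hx => h0 x fun y => by rw [hBapp, traceForm_comm]; exact hx y⟩
  let b : Basis (Fin (finrank ℂ I)) ℂ I := finBasis ℂ I
  let d := B.dualBasis hB b
  refine ⟨fun i => b i, fun i => d i, ?_, ?_⟩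
  · have : ∀ i, traceForm ℂ s W (b i) (d i) = 1 := by
      intro i
      have := LinearMap.BilinForm.apply_dualBasis_right hB hs b i i
      rw [if_pos rfl] at this
      exact this
    simp [this]
  · intro x Φ
    have e1 : ∀ i, ⁅x, (b i : s)⁆ = ∑ j, traceForm ℂ s W ⁅x, (b i : s)⁆ (d j) • (b j : s) := by
      intro i
      have h := b.sum_repr ⟨⁅x, (b i : s)⁆, I.lie_mem (b i).2⟩
      have h' := congrArg (Subtype.val) h
      refine h'.symm.trans ?_
      rw [AddSubmonoidClass.coe_finsetSum]
      refine Finset.sum_congr rfl fun j _ => ?_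
      have : b.repr ⟨⁅x, (b i : s)⁆, I.lie_mem (b i).2⟩ j
          = traceForm ℂ s W ⁅x, (b i : s)⁆ (d j) := by
        have h3 := LinearMap.BilinForm.dualBasis_repr_apply hB d ⟨⁅x, (b i : s)⁆, I.lie_mem (b i).2⟩ j
        rw [LinearMap.BilinForm.dualBasis_dualBasis hB hs] at h3
        exact h3
      rw [← this]
      rfl
    have e2 : ∀ i, ⁅x, (d i : s)⁆ = ∑ j, (- traceForm ℂ s W ⁅x, (b j : s)⁆ (d i)) • (d j : s) := by
      intro i
      have h := d.sum_repr ⟨⁅x, (d i : s)⁆, I.lie_mem (d i).2⟩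
      have h' := congrArg (Subtype.val) h
      refine h'.symm.trans ?_
      rw [AddSubmonoidClass.coe_finsetSum]
      refine Finset.sum_congr rfl fun j _ => ?_
      have : d.repr ⟨⁅x, (d i : s)⁆, I.lie_mem (d i).2⟩ j
          = - traceForm ℂ s W ⁅x, (b j : s)⁆ (d i) := by
        have h3 := LinearMap.BilinForm.dualBasis_repr_apply hB b ⟨⁅x, (d i : s)⁆, I.lie_mem (d i).2⟩ j
        rw [h3, hBapp]
        change traceForm ℂ s W ⁅x, (d i : s)⁆ (b j) = _
        rw [← lie_skew, map_neg, LinearMap.neg_apply, traceForm_apply_lie_apply,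
          traceForm_comm]
      rw [← this]
      rfl
    rw [Finset.sum_add_distrib]
    have f1 : ∑ i, Φ ⁅x, (b i : s)⁆ (d i) =
        ∑ i, ∑ j, traceForm ℂ s W ⁅x, (b i : s)⁆ (d j) • Φ (b j) (d i) := by
      refine Finset.sum_congr rfl fun i _ => ?_
      conv_lhs => rw [e1 i]
      simp [map_sum, LinearMap.sum_apply]
    have f2 : ∑ i, Φ (b i) ⁅x, (d i : s)⁆ =
        - ∑ i, ∑ j, traceForm ℂ s W ⁅x, (b j : s)⁆ (d i) • Φ (b i) (d j) := by
      rw [← Finset.sum_neg_distrib]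
      refine Finset.sum_congr rfl fun i _ => ?_
      conv_lhs => rw [e2 i]
      simp [map_sum]
    rw [f1, f2, Finset.sum_comm, add_neg_cancel]

theorem perfect_of_killing {s : Type*} [LieRing s] [LieAlgebra ℂ s] [FiniteDimensional ℂ s]
    [IsKilling ℂ s] : ⁅(⊤ : LieIdeal ℂ s), (⊤ : LieIdeal ℂ s)⁆ = ⊤ := by
  have h := LieIdeal.isCompl_killingCompl ⁅(⊤ : LieIdeal ℂ s), (⊤ : LieIdeal ℂ s)⁆
  have hb : LieIdeal.killingCompl ℂ s ⁅(⊤ : LieIdeal ℂ s), (⊤ : LieIdeal ℂ s)⁆ = ⊥ := by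
    rw [LieSubmodule.eq_bot_iff]
    intro y hy
    rw [LieIdeal.mem_killingCompl] at hy
    have hc : ∀ a : s, ⁅y, a⁆ = (0 : s) := by
      intro a
      refine (IsKilling.killingForm_nondegenerate ℂ s).1 _ fun b => ?_
      rw [traceForm_apply_lie_apply, traceForm_comm]
      exact hy _ (LieSubmodule.lie_mem_lie (LieSubmodule.mem_top a) (LieSubmodule.mem_top b))
    have : y ∈ LieAlgebra.center ℂ s := by
      rw [LieModule.mem_maxTrivSubmodule]
      intro a
      rw [← lie_skew, hc, neg_zero]
    rwa [LieAlgebra.center_eq_bot, LieSubmodule.mem_bot] at this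
  rw [hb] at h
  simpa using h.sup_eq_top

theorem whitehead {s : Type*} [LieRing s] [LieAlgebra ℂ s] [FiniteDimensional ℂ s]
    [IsKilling ℂ s] (n : ℕ) : ∀ (W : Type u) [AddCommGroup W] [Module ℂ W] [LieRingModule s W]
    [LieModule ℂ s W] [FiniteDimensional ℂ W], finrank ℂ W = n → ∀ f : s →ₗ[ℂ] W,
    (∀ x y, f ⁅x, y⁆ = ⁅x, f y⁆ - ⁅y, f x⁆) → ∃ w, ∀ x, f x = ⁅x, w⁆ := by
  induction n using Nat.strong_induction_on with
  | _ n ih =>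
  intro W _ _ _ _ _ hn f hf
  let I := LieIdeal.killingCompl ℂ s (LieModule.ker ℂ s W)
  have hcompl : IsCompl (LieModule.ker ℂ s W) I := LieIdeal.isCompl_killingCompl _
  have hker0 : ∀ x y, y ∈ LieModule.ker ℂ s W → traceForm ℂ s W x y = 0 := by
    intro x y hy
    have : toEnd ℂ s W y = 0 := by
      ext w; exact (LieModule.mem_ker ℂ s W y).1 hy w
    rw [traceForm_apply_apply, this, LinearMap.comp_zero, map_zero]
  have hdec : ∀ y : s, ∃ a ∈ LieModule.ker ℂ s W, ∃ b ∈ I, a + b = y := by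
    intro y
    have : y ∈ LieModule.ker ℂ s W ⊔ I := by rw [hcompl.sup_eq_top]; trivial
    exact (LieSubmodule.mem_sup _ _ _).1 this
  have hI : ∀ x ∈ I, (∀ y ∈ I, traceForm ℂ s W x y = 0) → x = 0 := by
    let K : LieIdeal ℂ s :=
      { carrier := {x | x ∈ I ∧ ∀ y, traceForm ℂ s W x y = 0}
        add_mem' := fun {a b} ha hb => ⟨I.add_mem ha.1 hb.1, fun y => by
          rw [map_add, LinearMap.add_apply, ha.2, hb.2, add_zero]⟩
        zero_mem' := ⟨I.zero_mem, fun y => by simp⟩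
        smul_mem' := fun c a ha => ⟨I.smul_mem c ha.1, fun y => by
          rw [map_smul, LinearMap.smul_apply, ha.2, smul_zero]⟩
        lie_mem := fun {x m} hm => ⟨I.lie_mem hm.1, fun y => by
          rw [← lie_skew, map_neg, LinearMap.neg_apply, traceForm_apply_lie_apply, hm.2, neg_zero]⟩ }
    have hK : K = ⊥ := by
      have : IsSolvable K := by
        refine solvable_of_faithful (W := W) ?_ ?_
        · intro x hx
          have h1 : (x : s) ∈ LieModule.ker ℂ s W := by
            rw [LieModule.mem_ker]; exact hx
          have h2 : (x : s) ∈ LieModule.ker ℂ s W ⊓ I := ⟨h1, x.2.1⟩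
          rw [hcompl.inf_eq_bot, LieSubmodule.mem_bot] at h2
          exact Subtype.ext h2
        · ext x y
          exact x.2.2 y
      exact HasTrivialRadical.eq_bot_of_isSolvable K
    intro x hx hxy
    have : x ∈ K := by
      refine ⟨hx, fun y => ?_⟩
      obtain ⟨a, ha, b, hb, rfl⟩ := hdec y
      rw [map_add, hker0 _ _ ha, hxy b hb, add_zero]
    rwa [hK, LieSubmodule.mem_bot] at this
  by_cases hIb : I = ⊥
  · -- trivial action
    have htriv : ∀ (x : s) (w : W), ⁅x, w⁆ = 0 := by
      intro x w
      obtain ⟨a, ha, b, hb, rfl⟩ := hdec x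
      rw [hIb, LieSubmodule.mem_bot] at hb
      rw [hb, add_zero]
      exact (LieModule.mem_ker ℂ s W a).1 ha w
    refine ⟨0, fun x => ?_⟩
    rw [lie_zero]
    have hx : x ∈ ⁅(⊤ : LieIdeal ℂ s), (⊤ : LieIdeal ℂ s)⁆ := by
      rw [perfect_of_killing]; trivial
    rw [← LieSubmodule.mem_toSubmodule, LieSubmodule.lieIdeal_oper_eq_linear_span'] at hx
    have hle : Submodule.span ℂ {x : s | ∃ y ∈ (⊤ : LieIdeal ℂ s), ∃ z ∈ (⊤ : LieIdeal ℂ s), ⁅y, z⁆ = x} ≤ LinearMap.ker f := by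
      rw [Submodule.span_le]
      rintro _ ⟨y, -, z, -, rfl⟩
      simp [hf, htriv]
    exact hle hx
  obtain ⟨b, b', htr, hinv⟩ := casimir_data (W := W) I hI
  let ρ := toEnd ℂ s W
  let C : Module.End ℂ W := ∑ i, ρ (b i) * ρ (b' i)
  have hCapp : ∀ w, C w = ∑ i, ⁅b i, ⁅b' i, w⁆⁆ := by
    intro w; simp [C, ρ, LinearMap.sum_apply]
  have htrC : LinearMap.trace ℂ W C ≠ 0 := by
    have : LinearMap.trace ℂ W C = finrank ℂ I := by
      rw [← htr, map_sum]; rfl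
    rw [this]
    intro h0
    have h1 : finrank ℂ I = 0 := by exact_mod_cast h0
    have h2 : I.toSubmodule = ⊥ := Submodule.finrank_eq_zero.1 h1
    exact hIb ((LieSubmodule.toSubmodule_eq_bot I).1 h2)
  have hCcomm : ∀ (x : s) (w : W), ⁅x, C w⁆ = C ⁅x, w⁆ := by
    intro x w
    let Φ : s →ₗ[ℂ] s →ₗ[ℂ] W := LinearMap.mk₂ ℂ (fun a c => ⁅a, ⁅c, w⁆⁆)
      (by intros; simp) (by intros; simp) (by intros; simp) (by intros; simp)
    have := hinv x Φ
    simp only [Φ, LinearMap.mk₂_apply] at this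
    rw [hCapp, hCapp, lie_sum, ← sub_eq_zero, ← Finset.sum_sub_distrib, ← this]
    refine Finset.sum_congr rfl fun i _ => ?_
    rw [leibniz_lie x (b i), leibniz_lie x (b' i) w, lie_add]
    abel
  let w₀ : W := ∑ i, ⁅b i, f (b' i)⁆
  have hw₀ : ∀ x, ⁅x, w₀⁆ = C (f x) := by
    intro x
    let Φ : s →ₗ[ℂ] s →ₗ[ℂ] W := LinearMap.mk₂ ℂ (fun a c => ⁅a, f c⁆)
      (by intros; simp) (by intros; simp) (by intros; simp) (by intros; simp)
    have := hinv x Φ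
    simp only [Φ, LinearMap.mk₂_apply] at this
    rw [hCapp, lie_sum, ← sub_eq_zero, ← Finset.sum_sub_distrib, ← this]
    refine Finset.sum_congr rfl fun i _ => ?_
    rw [leibniz_lie x (b i), hf, lie_sub]
    abel
  obtain ⟨N, hN⟩ := Filter.eventually_atTop.1 (LinearMap.eventually_isCompl_ker_pow_range_pow C)
  have hNc := hN (N + 1) (Nat.le_succ N)
  have hCpow : ∀ (m : ℕ) (x : s) (w : W), ⁅x, (C ^ m) w⁆ = (C ^ m) ⁅x, w⁆ := by
    intro m x
    induction m with
    | zero => intro w; simp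
    | succ m ihm => intro w; rw [pow_succ, Module.End.mul_apply, Module.End.mul_apply, ihm, hCcomm]
  have hu : ∀ x, ⁅x, (C ^ N) w₀⁆ = (C ^ (N + 1)) (f x) := by
    intro x; rw [hCpow, hw₀, pow_succ, Module.End.mul_apply]
  obtain ⟨uK, huK, uR, ⟨v, rfl⟩, huv⟩ : ∃ a ∈ (C ^ (N + 1)).ker, ∃ c ∈ (C ^ (N + 1)).range,
      a + c = (C ^ N) w₀ := by
    apply Submodule.mem_sup.1; rw [hNc.sup_eq_top]; trivial
  let Ksub : LieSubmodule ℂ s W :=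
    { (C ^ (N + 1)).ker with
      lie_mem := fun {x m} hm => by
        change (C ^ (N + 1)) ⁅x, m⁆ = 0
        have hm' : (C ^ (N + 1)) m = 0 := hm
        rw [← hCpow, hm', lie_zero] }
  have hmem : ∀ x, f x - ⁅x, v⁆ ∈ Ksub := by
    intro x
    have h1 := hu x
    rw [← huv, lie_add, hCpow] at h1
    have h2 : ⁅x, uK⁆ ∈ (C ^ (N + 1)).ker ⊓ (C ^ (N + 1)).range := by
      refine ⟨Ksub.lie_mem huK, ⟨f x - ⁅x, v⁆, ?_⟩⟩
      rw [map_sub, ← h1]; abel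
    rw [hNc.inf_eq_bot, Submodule.mem_bot] at h2
    change (C ^ (N + 1)) (f x - ⁅x, v⁆) = 0
    rw [map_sub, ← h1, h2]; abel
  have hlt : finrank ℂ Ksub < n := by
    rw [← hn]
    apply Submodule.finrank_lt (s := (C ^ (N + 1)).ker)
    intro htop
    have : C ^ (N + 1) = 0 := LinearMap.ker_eq_top.1 htop
    exact htrC ((LinearMap.isNilpotent_trace_of_isNilpotent ⟨N + 1, this⟩).eq_zero)
  let g : s →ₗ[ℂ] Ksub := 
    { toFun := fun x => ⟨f x - ⁅x, v⁆, hmem x⟩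
      map_add' := fun x y => by
        apply Subtype.ext
        change f (x + y) - ⁅x + y, v⁆ = (f x - ⁅x, v⁆) + (f y - ⁅y, v⁆)
        rw [map_add, add_lie]; abel
      map_smul' := fun c x => by
        apply Subtype.ext
        change f (c • x) - ⁅c • x, v⁆ = c • (f x - ⁅x, v⁆)
        rw [map_smul, smul_lie, smul_sub] }
  obtain ⟨w, hw⟩ := ih _ hlt Ksub rfl g (by
    intro x y
    apply Subtype.ext
    change f ⁅x, y⁆ - ⁅⁅x, y⁆, v⁆ = ⁅x, f y - ⁅y, v⁆⁆ - ⁅y, f x - ⁅x, v⁆⁆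
    rw [hf, lie_lie, lie_sub, lie_sub]; abel)
  refine ⟨(w : W) + v, fun x => ?_⟩
  have := congrArg Subtype.val (hw x)
  change f x - ⁅x, v⁆ = ⁅x, (w : W)⁆ at this
  rw [lie_add, ← this]; abel

section struct_sec
variable {k V : Type*} [LieRing k] [LieAlgebra ℂ k] [FiniteDimensional ℂ k]
    [AddCommGroup V] [Module ℂ V] [LieRingModule k V] [LieModule ℂ k V] [FiniteDimensional ℂ V]

theorem toEnd_bracket (y x : k) :
    toEnd ℂ k V ⁅y, x⁆ = toEnd ℂ k V y * toEnd ℂ k V x - toEnd ℂ k V x * toEnd ℂ k V y := by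
  ext v
  simp [lie_lie]

theorem tr_bracket (y x : k) (P : Module.End ℂ V) (hP : Commute P (toEnd ℂ k V x)) :
    LinearMap.trace ℂ V (toEnd ℂ k V ⁅y, x⁆ * P) = 0 := by
  rw [toEnd_bracket, sub_mul, map_sub, sub_eq_zero, mul_assoc, mul_assoc, ← hP.eq,
    ← mul_assoc, LinearMap.trace_mul_comm, ← mul_assoc, mul_assoc]

theorem commute_toEnd {x y : k} (h : ⁅x, y⁆ = 0) : Commute (toEnd ℂ k V x) (toEnd ℂ k V y) := by
  have := toEnd_bracket (V := V) x y
  rw [h, map_zero] at this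
  exact (sub_eq_zero.1 this.symm)

theorem tr_span (A B : LieIdeal ℂ k) (P : Module.End ℂ V)
    (hP : ∀ x ∈ B, Commute P (toEnd ℂ k V x)) (e : k) (he : e ∈ ⁅A, B⁆) :
    LinearMap.trace ℂ V (toEnd ℂ k V e * P) = 0 := by
  rw [← LieSubmodule.mem_toSubmodule, LieSubmodule.lieIdeal_oper_eq_linear_span'] at he
  let φ : k →ₗ[ℂ] ℂ := LinearMap.trace ℂ V ∘ₗ LinearMap.mulRight ℂ P ∘ₗ (toEnd ℂ k V : k →ₗ[ℂ] _)
  have hle : Submodule.span ℂ {x : k | ∃ y ∈ A, ∃ z ∈ B, ⁅y, z⁆ = x} ≤ LinearMap.ker φ := by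
    rw [Submodule.span_le]
    rintro _ ⟨y, -, z, hz, rfl⟩
    exact tr_bracket y z P (hP z hz)
  exact hle he

theorem central_of_abelian (hβ : ∀ x, (∀ y, traceForm ℂ k V x y = 0) → x = 0)
    (a : LieIdeal ℂ k) (ha : ∀ x ∈ a, ∀ y ∈ a, ⁅x, y⁆ = 0) :
    ∀ x ∈ a, ∀ y : k, ⁅y, x⁆ = 0 := by
  let J : LieIdeal ℂ k := ⁅(⊤ : LieIdeal ℂ k), a⁆
  have hJa : J ≤ a := LieSubmodule.lie_le_right _ _
  have hnil : ∀ c ∈ J, IsNilpotent (toEnd ℂ k V c) := by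
    intro c hc
    refine nilp_of_trace _ fun n => tr_span ⊤ a _ ?_ c hc
    intro x hx
    exact (commute_toEnd (ha c (hJa hc) x hx)).pow_left n
  have hJnil : LieModule.IsNilpotent J V := by
    rw [LieModule.isNilpotent_iff_forall' (R := ℂ)]
    intro x
    exact hnil x x.2
  obtain ⟨m, hm⟩ := (LieModule.isNilpotent_iff ℂ J V).1 hJnil
  let N : ℕ → LieSubmodule ℂ k V := fun j => Nat.rec ⊤ (fun _ M => ⁅J, M⁆) j
  have hNsucc : ∀ j, N (j + 1) = ⁅J, N j⁆ := fun _ => rfl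
  have hN : ∀ j, (N j).toSubmodule ≤ (lowerCentralSeries ℂ J V j).toSubmodule := by
    intro j
    induction j with
    | zero => simp
    | succ j ih =>
      rw [hNsucc, LieSubmodule.lieIdeal_oper_eq_linear_span', Submodule.span_le]
      rintro _ ⟨x, hx, n, hn, rfl⟩
      rw [lowerCentralSeries_succ]
      exact LieSubmodule.lie_mem_lie (x := (⟨x, hx⟩ : J)) (LieSubmodule.mem_top _) (ih hn)
  have hNm : ∀ v ∈ N m, v = 0 := by
    intro v hv
    have := hN m hv
    rw [hm] at this
    simpa using this
  have hzero : ∀ c ∈ J, c = 0 := by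
    intro c hc
    refine hβ c fun y => ?_
    rw [traceForm_comm, traceForm_apply_apply]
    refine (LinearMap.isNilpotent_trace_of_isNilpotent ⟨m, ?_⟩).eq_zero
    have key : ∀ (j : ℕ) (v : V),
        ((((toEnd ℂ k V y) ∘ₗ (toEnd ℂ k V c)) : Module.End ℂ V) ^ j) v ∈ N j := by
      intro j
      induction j with
      | zero => intro v; exact LieSubmodule.mem_top v
      | succ j ih =>
        intro v
        rw [pow_succ', Module.End.mul_apply, hNsucc]
        exact LieSubmodule.lie_mem _ (LieSubmodule.lie_mem_lie hc (ih v))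
    ext v
    exact hNm _ (key m v)
  intro x hx y
  exact hzero _ (LieSubmodule.lie_mem_lie (LieSubmodule.mem_top y) hx)

theorem central_inf_derived (hβ : ∀ x, (∀ y, traceForm ℂ k V x y = 0) → x = 0)
    (x : k) (hx : ∀ y : k, ⁅y, x⁆ = 0)
    (hx' : x ∈ ⁅(⊤ : LieIdeal ℂ k), (⊤ : LieIdeal ℂ k)⁆) : x = 0 := by
  have hc : ∀ y, Commute (toEnd ℂ k V x) (toEnd ℂ k V y) := fun y =>
    (commute_toEnd (hx y)).symm
  have hn : IsNilpotent (toEnd ℂ k V x) :=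
    nilp_of_trace _ fun n => tr_span ⊤ ⊤ _ (fun y _ => (hc y).pow_left n) x hx'
  refine hβ x fun y => ?_
  rw [traceForm_apply_apply]
  exact (LinearMap.isNilpotent_trace_of_isNilpotent ((hc y).isNilpotent_mul_right hn)).eq_zero

theorem decomp (hβ : ∀ x, (∀ y, traceForm ℂ k V x y = 0) → x = 0) (x : k) :
    ∃ d ∈ ⁅(⊤ : LieIdeal ℂ k), (⊤ : LieIdeal ℂ k)⁆, ∃ z : k, (∀ y : k, ⁅y, z⁆ = 0) ∧ d + z = x := by
  let D := ⁅(⊤ : LieIdeal ℂ k), (⊤ : LieIdeal ℂ k)⁆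
  let B : LinearMap.BilinForm ℂ k := traceForm ℂ k V
  have hcen : ∀ z ∈ B.orthogonal D.toSubmodule, ∀ y : k, ⁅y, z⁆ = 0 := by
    intro z hz y
    refine hβ _ fun w => ?_
    rw [← lie_skew, map_neg, LinearMap.neg_apply, traceForm_apply_lie_apply, neg_eq_zero,
      traceForm_comm]
    exact hz _ (LieSubmodule.lie_mem_lie (LieSubmodule.mem_top y) (LieSubmodule.mem_top w))
  have hdisj : Disjoint D.toSubmodule (B.orthogonal D.toSubmodule) := by
    rw [Submodule.disjoint_def]
    intro z hz hz'
    exact central_inf_derived hβ z (hcen z hz') hz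
  have hrefl : B.IsRefl := (traceForm_isSymm ℂ k V).isRefl
  have hcompl := (LinearMap.BilinForm.isCompl_orthogonal_iff_disjoint hrefl).2 hdisj
  have hx : x ∈ D.toSubmodule ⊔ (B.orthogonal D.toSubmodule) := by
    rw [hcompl.sup_eq_top]; trivial
  obtain ⟨d, hd, z, hz, h⟩ := Submodule.mem_sup.1 hx
  exact ⟨d, hd, z, hcen z hz, h⟩

theorem derived_killing (hβ : ∀ x, (∀ y, traceForm ℂ k V x y = 0) → x = 0) :
    IsKilling ℂ (⁅(⊤ : LieIdeal ℂ k), (⊤ : LieIdeal ℂ k)⁆ : LieIdeal ℂ k) := by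
  have : HasTrivialRadical ℂ (⁅(⊤ : LieIdeal ℂ k), (⊤ : LieIdeal ℂ k)⁆ : LieIdeal ℂ k) := by
    rw [hasTrivialRadical_iff_no_abelian_ideals]
    intro I hI
    let a : LieIdeal ℂ k :=
      { I.toSubmodule.map (Submodule.subtype
          (⁅(⊤ : LieIdeal ℂ k), (⊤ : LieIdeal ℂ k)⁆ : LieIdeal ℂ k).toSubmodule) with
        lie_mem := by
          rintro y _ ⟨m, hm, rfl⟩
          obtain ⟨d, hd, z, hz, rfl⟩ := decomp hβ y
          refine ⟨⁅(⟨d, hd⟩ : (⁅(⊤ : LieIdeal ℂ k), (⊤ : LieIdeal ℂ k)⁆ : LieIdeal ℂ k)), m⁆,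
            I.lie_mem hm, ?_⟩
          change ⁅d, (m : k)⁆ = ⁅d + z, (m : k)⁆
          rw [add_lie, ← lie_skew z, hz, neg_zero, add_zero] }
    have hab : ∀ x ∈ a, ∀ y ∈ a, ⁅x, y⁆ = 0 := by
      rintro _ ⟨x, hx, rfl⟩ _ ⟨y, hy, rfl⟩
      have h := hI.trivial ⟨x, hx⟩ ⟨y, hy⟩
      exact congrArg (fun t : I => ((t : (⁅(⊤ : LieIdeal ℂ k), (⊤ : LieIdeal ℂ k)⁆ :
        LieIdeal ℂ k)) : k)) h
    have hcen := central_of_abelian hβ a hab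
    rw [LieSubmodule.eq_bot_iff]
    intro x hx
    apply Subtype.ext
    exact central_inf_derived hβ (x : k) (hcen _ ⟨x, hx, rfl⟩) x.2
  infer_instance
end struct_sec

theorem semis_split {A : Type*} [AddCommGroup A] [Module ℂ A] [FiniteDimensional ℂ A]
    (D : Module.End ℂ A) (hD : D.IsSemisimple) (p : Submodule ℂ A) (hp : ∀ x ∈ p, D x ∈ p)
    (m : A) (hm : m ∈ p) : ∃ a ∈ p, ∃ b ∈ p, D a = 0 ∧ m = a + D b := by
  have hR := hD.restrict hp
  obtain ⟨q, hq, hc⟩ := (Module.End.isSemisimple_iff.1 hR) (LinearMap.ker (D.restrict hp))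
    (by
      intro x hx
      simp only [Submodule.mem_comap, LinearMap.mem_ker] at hx ⊢
      rw [hx, map_zero])
  have hinj : Function.Injective ((D.restrict hp).restrict hq) := by
    rw [← LinearMap.ker_eq_bot, LinearMap.ker_eq_bot']
    intro x hx
    have hx1 : (x : p) ∈ LinearMap.ker (D.restrict hp) := by
      rw [LinearMap.mem_ker]
      exact congrArg Subtype.val hx
    apply Subtype.ext
    exact (Submodule.disjoint_def.1 hc.disjoint) _ hx1 x.2
  have hsurj := LinearMap.injective_iff_surjective.1 hinj
  have : (⟨m, hm⟩ : p) ∈ LinearMap.ker (D.restrict hp) ⊔ q := by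
    rw [hc.sup_eq_top]; trivial
  obtain ⟨a, ha, c, hcq, hac⟩ := Submodule.mem_sup.1 this
  obtain ⟨b, hb⟩ := hsurj ⟨c, hcq⟩
  refine ⟨a, a.2, (b : p), (b : p).2, ?_, ?_⟩
  · exact congrArg Subtype.val (LinearMap.mem_ker.1 ha)
  · have h1 := congrArg Subtype.val hac
    have h2 : D ((b : p) : A) = c := congrArg (fun t : q => ((t : p) : A)) hb
    rw [h2]; exact h1.symm

theorem torus_inv {A ι : Type*} [AddCommGroup A] [Module ℂ A] [FiniteDimensional ℂ A]
    (D : ι → Module.End ℂ A) (M E : Submodule ℂ A) (hEM : E ≤ M) (S : Finset ι)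
    (hss : ∀ i ∈ S, (D i).IsSemisimple) (hcomm : ∀ i ∈ S, ∀ j ∈ S, Commute (D i) (D j))
    (hD : ∀ i ∈ S, ∀ x ∈ M, D i x ∈ E) (x : A) (hx : x ∈ M) :
    ∃ m ∈ M, x - m ∈ E ∧ ∀ i ∈ S, D i m = 0 := by
  classical
  induction S using Finset.induction_on with
  | empty => exact ⟨x, hx, by simp, by simp⟩
  | insert i S hi ih =>
    obtain ⟨m0, hm0, hxm, hk⟩ := ih (fun j hj => hss j (Finset.mem_insert_of_mem hj))
      (fun j hj l hl => hcomm j (Finset.mem_insert_of_mem hj) l (Finset.mem_insert_of_mem hl))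
      (fun j hj => hD j (Finset.mem_insert_of_mem hj))
    have hiS := Finset.mem_insert_self i S
    let M0 : Submodule ℂ A := M ⊓ ⨅ j ∈ S, LinearMap.ker (D j)
    have hM0 : ∀ y, y ∈ M0 ↔ y ∈ M ∧ ∀ j ∈ S, D j y = 0 := by
      intro y
      simp [M0, Submodule.mem_iInf]
    obtain ⟨a, ha, b, hb, hDa, hab⟩ := semis_split (D i) (hss i hiS) M0 (by
      intro y hy
      rw [hM0] at hy ⊢
      refine ⟨hEM (hD i hiS y hy.1), fun j hj => ?_⟩
      have := congrArg (fun f => f y) (hcomm i hiS j (Finset.mem_insert_of_mem hj)).eq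
      simp only [Module.End.mul_apply] at this
      rw [← this, hy.2 j hj, map_zero]) m0 ((hM0 _).2 ⟨hm0, hk⟩)
    rw [hM0] at ha hb
    refine ⟨a, ha.1, ?_, ?_⟩
    · have : x - a = (x - m0) + D i b := by rw [hab]; abel
      rw [this]
      exact E.add_mem hxm (hD i hiS b hb.1)
    · intro j hj
      rcases Finset.mem_insert.1 hj with rfl | hj
      · exact hDa
      · exact ha.2 j hj

section
attribute [local instance] LieRing.ofAssociativeRing
theorem hom_semis {k V : Type*} [LieRing k] [LieAlgebra ℂ k]
    [AddCommGroup V] [Module ℂ V] [LieRingModule k V] [LieModule ℂ k V] [FiniteDimensional ℂ V]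
    (z : k) (hz : (toEnd ℂ k V z).IsSemisimple) :
    (toEnd ℂ k (V →ₗ[ℂ] V) z).IsSemisimple := by
  have h := LieAlgebra.ad_isSemisimple_of_isSemisimple (a := toEnd ℂ k V z) hz
  have e : toEnd ℂ k (V →ₗ[ℂ] V) z = LieAlgebra.ad ℂ (Module.End ℂ V) (toEnd ℂ k V z) := by
    ext φ v
    simp [LieHom.lie_apply, LieRing.of_associative_ring_bracket]
  rw [e]; exact h
end

theorem complement {k : Type*} {V : Type u} [LieRing k] [LieAlgebra ℂ k] [FiniteDimensional ℂ k]
    [AddCommGroup V] [Module ℂ V] [LieRingModule k V] [LieModule ℂ k V] [FiniteDimensional ℂ V]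
    (hβ : ∀ x, (∀ y, traceForm ℂ k V x y = 0) → x = 0)
    (hss : ∀ z : k, (∀ y : k, ⁅y, z⁆ = 0) → (toEnd ℂ k V z).IsSemisimple)
    (U : Submodule ℂ V) (hU : ∀ x : k, ∀ u ∈ U, ⁅x, u⁆ ∈ U) :
    ∃ U' : Submodule ℂ V, (∀ x : k, ∀ u ∈ U', ⁅x, u⁆ ∈ U') ∧ IsCompl U U' := by
  let Z : Submodule ℂ k :=
    { carrier := {z | ∀ y : k, ⁅y, z⁆ = 0}
      add_mem' := by intro a b ha hb y; rw [lie_add, ha y, hb y, add_zero]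
      zero_mem' := by intro y; exact lie_zero y
      smul_mem' := by intro c a ha y; rw [lie_smul, ha y, smul_zero] }
  let E : Submodule ℂ (V →ₗ[ℂ] V) :=
    { carrier := {φ | (∀ v, φ v ∈ U) ∧ ∀ u ∈ U, φ u = 0}
      add_mem' := by
        intro a b ha hb
        exact ⟨fun v => U.add_mem (ha.1 v) (hb.1 v), fun u hu => by
          rw [LinearMap.add_apply, ha.2 u hu, hb.2 u hu, add_zero]⟩
      zero_mem' := ⟨fun v => U.zero_mem, fun u _ => rfl⟩
      smul_mem' := by
        intro c a ha
        exact ⟨fun v => U.smul_mem c (ha.1 v), fun u hu => by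
          rw [LinearMap.smul_apply, ha.2 u hu, smul_zero]⟩ }
  let M : Submodule ℂ (V →ₗ[ℂ] V) :=
    { carrier := {φ | (∀ v, φ v ∈ U) ∧ ∃ c : ℂ, ∀ u ∈ U, φ u = c • u}
      add_mem' := by
        rintro a b ⟨ha, c, hc⟩ ⟨hb, d, hd⟩
        exact ⟨fun v => U.add_mem (ha v) (hb v), c + d, fun u hu => by
          rw [LinearMap.add_apply, hc u hu, hd u hu, add_smul]⟩
      zero_mem' := ⟨fun v => U.zero_mem, 0, fun u _ => by simp⟩
      smul_mem' := by
        rintro t a ⟨ha, c, hc⟩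
        exact ⟨fun v => U.smul_mem t (ha v), t * c, fun u hu => by
          rw [LinearMap.smul_apply, hc u hu, mul_smul]⟩ }
  have hEM : E ≤ M := fun φ h => ⟨h.1, 0, fun u hu => by rw [h.2 u hu, zero_smul]⟩
  have hME : ∀ (x : k), ∀ φ ∈ M, ⁅x, φ⁆ ∈ E := by
    rintro x φ ⟨h1, c, hc⟩
    refine ⟨fun v => ?_, fun u hu => ?_⟩
    · rw [LieHom.lie_apply]
      exact U.sub_mem (hU x _ (h1 v)) (h1 _)
    · rw [LieHom.lie_apply, hc u hu, hc _ (hU x u hu), lie_smul, sub_self]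
  obtain ⟨S, hS⟩ := IsNoetherian.noetherian Z
  have hSZ : ∀ z ∈ S, z ∈ Z := fun z hz => by rw [← hS]; exact Submodule.subset_span hz
  -- a linear projection
  obtain ⟨Q, hQ⟩ := U.exists_isCompl
  let p : V →ₗ[ℂ] V := U.subtype ∘ₗ U.linearProjOfIsCompl Q hQ
  have hpU : ∀ v, p v ∈ U := fun v => Subtype.property _
  have hpid : ∀ u ∈ U, p u = u := fun u hu => by
    exact congrArg Subtype.val (Submodule.linearProjOfIsCompl_apply_left hQ ⟨u, hu⟩)
  obtain ⟨π0, -, hπE, hπ0⟩ := torus_inv (fun z : k => toEnd ℂ k (V →ₗ[ℂ] V) z) M E hEM S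
    (fun z hz => hom_semis z (hss z (hSZ z hz)))
    (fun z hz w hw => commute_toEnd (hSZ w hw z))
    (fun z _ φ hφ => hME z φ hφ) p ⟨hpU, 1, fun u hu => by rw [hpid u hu, one_smul]⟩
  have hπ0U : ∀ v, π0 v ∈ U := fun v => by
    have := U.sub_mem (hpU v) (hπE.1 v)
    simpa using this
  have hπ0id : ∀ u ∈ U, π0 u = u := fun u hu => by
    have := hπE.2 u hu
    rw [LinearMap.sub_apply, hpid u hu, sub_eq_zero] at this
    exact this.symm
  have hπ0Z : ∀ z ∈ Z, ⁅z, π0⁆ = 0 := by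
    intro z hz
    rw [← hS] at hz
    induction hz using Submodule.span_induction with
    | mem x h => exact hπ0 x h
    | zero => exact zero_lie _
    | add x y _ _ hx hy => rw [add_lie, hx, hy, add_zero]
    | smul c x _ hx => rw [smul_lie, hx, smul_zero]
  have hπ0M : π0 ∈ M := ⟨hπ0U, 1, fun u hu => by rw [hπ0id u hu, one_smul]⟩
  let s : LieIdeal ℂ k := ⁅(⊤ : LieIdeal ℂ k), (⊤ : LieIdeal ℂ k)⁆
  have hK : IsKilling ℂ s := derived_killing hβ
  have hcz : ∀ (x : k) (φ : V →ₗ[ℂ] V), (∀ z ∈ Z, ⁅z, φ⁆ = 0) → ∀ z ∈ Z, ⁅z, ⁅x, φ⁆⁆ = 0 := by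
    intro x φ h z hz
    rw [leibniz_lie, h z hz, lie_zero, add_zero, ← lie_skew, hz x, neg_zero, zero_lie]
  let W : LieSubmodule ℂ s (V →ₗ[ℂ] V) :=
    { carrier := {φ | φ ∈ E ∧ ∀ z ∈ Z, ⁅z, φ⁆ = 0}
      add_mem' := by
        intro a b ha hb
        exact ⟨E.add_mem ha.1 hb.1, fun z hz => by rw [lie_add, ha.2 z hz, hb.2 z hz, add_zero]⟩
      zero_mem' := ⟨E.zero_mem, fun z _ => lie_zero z⟩
      smul_mem' := by
        intro c a ha
        exact ⟨E.smul_mem c ha.1, fun z hz => by rw [lie_smul, ha.2 z hz, smul_zero]⟩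
      lie_mem := by
        intro x φ h
        exact ⟨hME (x : k) φ (hEM h.1), hcz (x : k) φ h.2⟩ }
  let f : s →ₗ[ℂ] W :=
    { toFun := fun x => ⟨⁅(x : k), π0⁆, hME (x : k) π0 hπ0M, hcz (x : k) π0 hπ0Z⟩
      map_add' := fun x y => Subtype.ext (add_lie (x : k) (y : k) π0)
      map_smul' := fun c x => Subtype.ext (smul_lie c (x : k) π0) }
  obtain ⟨φ, hφ⟩ := whitehead (s := s) _ W rfl f (fun x y => Subtype.ext
    (lie_lie (x : k) (y : k) π0))
  have hφ' : ∀ x ∈ s, ⁅x, π0⁆ = ⁅x, (φ : V →ₗ[ℂ] V)⁆ := fun x hx =>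
    congrArg Subtype.val (hφ ⟨x, hx⟩)
  obtain ⟨φ, hφE, hφZ⟩ := φ
  simp only at hφ'
  have hπ : ∀ x : k, ⁅x, π0 - φ⁆ = 0 := by
    intro x
    obtain ⟨d, hd, z, hz, rfl⟩ := decomp hβ x
    rw [add_lie, lie_sub, lie_sub, hφ' d hd, hπ0Z z hz, hφZ z hz, sub_self, sub_self, add_zero]
  have hπU : ∀ v, (π0 - φ) v ∈ U := fun v => U.sub_mem (hπ0U v) (hφE.1 v)
  have hπid : ∀ u ∈ U, (π0 - φ) u = u := fun u hu => by
    rw [LinearMap.sub_apply, hπ0id u hu, hφE.2 u hu, sub_zero]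
  refine ⟨LinearMap.ker (π0 - φ), fun x u hu => ?_, ?_⟩
  · rw [LinearMap.mem_ker] at hu ⊢
    have := congrArg (fun g : V →ₗ[ℂ] V => g u) (hπ x)
    simp only [LieHom.lie_apply, hu, lie_zero, zero_sub, LinearMap.zero_apply, neg_eq_zero] at this
    exact this
  · refine ⟨?_, ?_⟩
    · rw [Submodule.disjoint_def]
      intro u hu hu'
      rw [← hπid u hu]; exact hu'
    · rw [codisjoint_iff_le_sup]
      intro v _
      refine Submodule.mem_sup.2 ⟨(π0 - φ) v, hπU v, v - (π0 - φ) v, ?_, by abel⟩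
      rw [LinearMap.mem_ker, map_sub, hπid _ (hπU v), sub_self]

section
variable {L : Type*} [LieRing L] [LieAlgebra ℂ L] [FiniteDimensional ℂ L]

theorem jordan_inner [IsKilling ℂ L] (x : L) :
    ∃ y : L, (ad ℂ L y).IsSemisimple ∧ IsNilpotent (ad ℂ L (x - y)) ∧
      ad ℂ L (x - y) ∈ Algebra.adjoin ℂ {ad ℂ L x} := by
  obtain ⟨N, hN₀, S, hS₁, hN, hS, hSN⟩ := (ad ℂ L x).exists_isNilpotent_isSemisimple
  have hS₀ : Commute (ad ℂ L x) S := Algebra.commute_of_mem_adjoin_self hS₁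
  have hN' := hN
  rw [eq_sub_of_add_eq hSN.symm] at hN'
  have aux {α : ℂ} {y : L} (hy : y ∈ (ad ℂ L x).maxGenEigenspace α) : S y = α • y := by
    rw [Module.End.maxGenEigenspace_eq] at hy
    rw [Module.End.apply_eq_of_mem_of_comm_of_isFinitelySemisimple_of_isNil hy hS₀
      hS.isFinitelySemisimple hN']
  have h_der (y z : L) (α β : ℂ) (hy : y ∈ (ad ℂ L x).maxGenEigenspace α)
      (hz : z ∈ (ad ℂ L x).maxGenEigenspace β) :
      S ⁅y, z⁆ = ⁅S y, z⁆ + ⁅y, S z⁆ := by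
    have hyz : ⁅y, z⁆ ∈ (ad ℂ L x).maxGenEigenspace (α + β) :=
      LieModule.lie_mem_maxGenEigenspace_toEnd hy hz
    rw [aux hy, aux hz, aux hyz, smul_lie, lie_smul, ← add_smul]
  replace h_der (y z : L) : S ⁅y, z⁆ = ⁅S y, z⁆ + ⁅y, S z⁆ := by
    have hy : y ∈ ⨆ α : ℂ, (ad ℂ L x).maxGenEigenspace α := by
      simp [Module.End.iSup_maxGenEigenspace_eq_top]
    have hz : z ∈ ⨆ α : ℂ, (ad ℂ L x).maxGenEigenspace α := by
      simp [Module.End.iSup_maxGenEigenspace_eq_top]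
    induction hy using Submodule.iSup_induction' with
    | mem α y hy =>
      induction hz using Submodule.iSup_induction' with
      | mem β z hz => exact h_der y z α β hy hz
      | zero => simp
      | add _ _ _ _ h h' => simp only [lie_add, map_add, h, h']; abel
    | zero => simp
    | add _ _ _ _ h h' => simp only [add_lie, map_add, h, h']; abel
  replace h_der : ∀ y z : L, S ⁅y, z⁆ = ⁅y, S z⁆ - ⁅z, S y⁆ := by
    simp_rw [← lie_skew (S _) _, add_comm, ← sub_eq_add_neg] at h_der; assumption
  let S' : LieDerivation ℂ L L := ⟨S, h_der⟩
  obtain ⟨y, hy⟩ := LieDerivation.IsKilling.exists_eq_ad S'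
  have hy : S = ad ℂ L y := by rw [← LieDerivation.coe_ad_apply_eq_ad_apply y, hy]
  have hxy : ad ℂ L (x - y) = N := by rw [map_sub, hSN, hy, add_sub_cancel_right]
  exact ⟨y, hy ▸ hS, hxy ▸ hN, hxy ▸ hN₀⟩

theorem main {L : Type u} [LieRing L] [LieAlgebra ℂ L] [FiniteDimensional ℂ L]
    [LieAlgebra.IsSemisimple ℂ L]
    (m : ℕ) (hm : 1 ≤ m) (θ : L ≃ₗ⁅ℂ⁆ L)
    (hθ : (θ.toLinearEquiv : L ≃ₗ[ℂ] L) ^ m = 1) (U : Submodule ℂ L)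
    (hU : ∀ x : L, θ x = x → ∀ u ∈ U, ⁅x, u⁆ ∈ U) :
    ∃ U' : Submodule ℂ L, (∀ x : L, θ x = x → ∀ u ∈ U', ⁅x, u⁆ ∈ U') ∧ IsCompl U U' := by
  have hK : IsKilling ℂ L := inferInstance
  let k : LieSubalgebra ℂ L :=
    { carrier := {x | θ x = x}
      add_mem' := by intro a b ha hb; change θ (a + b) = a + b; rw [map_add, ha, hb]
      zero_mem' := map_zero θ
      smul_mem' := by intro c a ha; change θ (c • a) = c • a; rw [map_smul, ha]
      lie_mem' := by intro a b ha hb; change θ ⁅a, b⁆ = ⁅a, b⁆; rw [LieEquiv.map_lie, ha, hb] }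
  have hκ : ∀ x : L, (∀ y, killingForm ℂ L x y = 0) → x = 0 := by
    intro x hx
    exact (IsKilling.killingForm_nondegenerate ℂ L).1 x hx
  have hiter : ∀ (i : ℕ) (y : L), ((θ.toLinearEquiv : L ≃ₗ[ℂ] L) ^ (i + 1)) y
      = θ (((θ.toLinearEquiv : L ≃ₗ[ℂ] L) ^ i) y) := by
    intro i y
    rw [pow_succ']; rfl
  have hβ' : ∀ x : L, θ x = x → (∀ y : L, θ y = y → killingForm ℂ L x y = 0) → x = 0 := by
    intro x hx h
    refine hκ x fun y => ?_
    have hinv : ∀ i : ℕ, killingForm ℂ L x (((θ.toLinearEquiv : L ≃ₗ[ℂ] L) ^ i) y)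
        = killingForm ℂ L x y := by
      intro i
      induction i with
      | zero => simp
      | succ i ih =>
        rw [hiter, ← ih]
        conv_lhs => rw [← hx]
        exact killingForm_of_equiv_apply θ _ _
    have hfix : θ (∑ i ∈ Finset.range m, ((θ.toLinearEquiv : L ≃ₗ[ℂ] L) ^ i) y)
        = ∑ i ∈ Finset.range m, ((θ.toLinearEquiv : L ≃ₗ[ℂ] L) ^ i) y := by
      rw [map_sum]
      simp_rw [← hiter]
      have h1 := Finset.sum_range_succ (fun i => ((θ.toLinearEquiv : L ≃ₗ[ℂ] L) ^ i) y) m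
      have h2 := Finset.sum_range_succ' (fun i => ((θ.toLinearEquiv : L ≃ₗ[ℂ] L) ^ i) y) m
      rw [h1, hθ, pow_zero] at h2
      exact (add_right_cancel h2).symm
    have := h _ hfix
    rw [map_sum, Finset.sum_congr rfl (fun i _ => hinv i), Finset.sum_const, Finset.card_range,
      nsmul_eq_mul, mul_eq_zero] at this
    rcases this with h0 | h0
    · exact absurd (Nat.cast_eq_zero.1 h0) (by omega)
    · exact h0
  have hβ : ∀ x : k, (∀ y : k, traceForm ℂ k L x y = 0) → x = 0 := by
    intro x hx
    exact Subtype.ext (hβ' x x.2 fun y hy => hx ⟨y, hy⟩)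
  have hss : ∀ z : k, (∀ y : k, ⁅y, z⁆ = 0) → (toEnd ℂ k L z).IsSemisimple := by
    rintro ⟨x, hx⟩ hz
    obtain ⟨y, hys, hn, hadj⟩ := jordan_inner x
    have hcomm : ∀ T : Module.End ℂ L, Commute T (ad ℂ L x) → Commute T (ad ℂ L (x - y)) := by
      intro T hT
      have : Algebra.adjoin ℂ {ad ℂ L x} ≤ Subalgebra.centralizer ℂ {T} := by
        refine Algebra.adjoin_le ?_
        rintro _ rfl
        rw [SetLike.mem_coe, Subalgebra.mem_centralizer_iff]
        rintro _ rfl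
        exact hT.eq
      exact (Subalgebra.mem_centralizer_iff ℂ).1 (this hadj) T rfl
    have hfix : θ (x - y) = x - y := by
      have h1 := hcomm (θ.toLinearEquiv : L →ₗ[ℂ] L) (by
        ext v
        change θ ⁅x, v⁆ = ⁅x, θ v⁆
        rw [LieEquiv.map_lie, hx])
      have h2 : ad ℂ L (θ (x - y) - (x - y)) = 0 := by
        ext v
        have h3 := congrArg (fun g : Module.End ℂ L => g (θ.symm v)) h1.eq
        change θ ⁅x - y, θ.symm v⁆ = ⁅x - y, θ (θ.symm v)⁆ at h3
        rw [LieEquiv.map_lie, LieEquiv.apply_symm_apply] at h3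
        rw [ad_apply, sub_lie, h3, sub_self]; rfl
      refine sub_eq_zero.1 (hκ _ fun w => ?_)
      rw [killingForm_apply_apply, h2, LinearMap.zero_comp, map_zero]
    have hzero : x - y = 0 := by
      refine hβ' _ hfix fun w hw => ?_
      have hc := hcomm (ad ℂ L w) (by
        have : ⁅w, x⁆ = 0 := congrArg Subtype.val (hz ⟨w, hw⟩)
        exact commute_toEnd this)
      rw [killingForm_apply_apply]
      exact (LinearMap.isNilpotent_trace_of_isNilpotent
        (hc.symm.isNilpotent_mul_right hn)).eq_zero
    have hxy : x = y := sub_eq_zero.1 hzero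
    rw [← hxy] at hys
    exact hys
  obtain ⟨U', h1, h2⟩ := complement hβ hss U (fun x u hu => hU x x.2 u hu)
  exact ⟨U', fun x hx u hu => h1 ⟨x, hx⟩ u hu, h2⟩
end
end RedFix

/-- If `θ` is a finite-order automorphism of a finite-dimensional semisimple complex Lie
algebra `L`, then the fixed-point subalgebra `L^θ` is reductive in `L`: every
`ad(L^θ)`-invariant subspace of `L` admits an `ad(L^θ)`-invariant complement, i.e. `L` is a
semisimple `L^θ`-module for the adjoint action. -/
theorem stmt7 (L : Type*) [LieRing L] [LieAlgebra ℂ L] [FiniteDimensional ℂ L]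
    [LieAlgebra.IsSemisimple ℂ L]
    (m : ℕ) (hm : 1 ≤ m) (θ : L ≃ₗ⁅ℂ⁆ L)
    (hθ : (θ.toLinearEquiv : L ≃ₗ[ℂ] L) ^ m = 1) :
    ∀ U : Submodule ℂ L, (∀ x : L, θ x = x → ∀ u ∈ U, ⁅x, u⁆ ∈ U) →
      ∃ U' : Submodule ℂ L, (∀ x : L, θ x = x → ∀ u ∈ U', ⁅x, u⁆ ∈ U') ∧ IsCompl U U' := by
  intro U hU
  exact RedFix.main m hm θ hθ U hU
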